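/- There is a well-defined bilinear form σ on V := range(M − Id) such that σ((M − Id)(ξ), (M − Id)(η)) = (1/2)(B(ξ, M(η)) − B(η, M(ξ))) for all ξ, η ∈ g (the right-hand side is independent of the choices of ξ and η representing the given elements of V). This form σ is alternating, and it satisfies the fiberwise momentum condition of the inclusion of a conjugacy class: σ((M − Id)(ξ), v) = (1/2) B(ξ, v + M⁻¹(v)) for all ξ ∈ g and v ∈ V. -/

import Mathlib

/-- The (right-translated) tangent space `V = range(M − Id)` of a conjugacy class,
where `M` plays the role of `Ad_q`. -/
def conjTangent (K : Type*) {g : Type*} [Field K] [AddCommGroup g] [Module K g]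
    (M : g ≃ₗ[K] g) : Submodule K g :=
  LinearMap.range ((M : g →ₗ[K] g) - LinearMap.id)

theorem mem_conjTangent (K : Type*) {g : Type*} [Field K] [AddCommGroup g] [Module K g]
    (M : g ≃ₗ[K] g) (ξ : g) : M ξ - ξ ∈ conjTangent K M := by
  show M ξ - ξ ∈ LinearMap.range ((M : g →ₗ[K] g) - LinearMap.id)
  rw [LinearMap.mem_range]
  exact ⟨ξ, by simp⟩

/-- For `M` orthogonal, the pairing of `ξ` with `v + M⁻¹ v`, where `v = (M − Id)η`. -/
theorem apply_add_symm_of_orthogonal {K g : Type*} [Field K] [AddCommGroup g] [Module K g]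
    (B : g →ₗ[K] Module.Dual K g) (M : g ≃ₗ[K] g) (horth : ∀ x y : g, B (M x) (M y) = B x y)
    (ξ η : g) :
    B ξ ((M η - η) + M.symm (M η - η)) = B ξ (M η) - B (M ξ) η := by
  have h : B ξ (M.symm η) = B (M ξ) η := by simpa using (horth ξ (M.symm η)).symm
  simp only [map_add, map_sub, LinearEquiv.symm_apply_apply, h]
  ring

/-- A right inverse of `M − Id` onto its range. -/
theorem exists_section_conjTangent {K g : Type*} [Field K] [AddCommGroup g] [Module K g]
    (M : g ≃ₗ[K] g) :
    ∃ s : ↥(conjTangent K M) →ₗ[K] g, ∀ v : ↥(conjTangent K M), M (s v) - s v = v := by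
  obtain ⟨s, hs⟩ := ((M : g →ₗ[K] g) - LinearMap.id).rangeRestrict.exists_rightInverse_of_surjective
    (LinearMap.range_rangeRestrict _)
  exact ⟨s, fun v => congrArg Subtype.val (LinearMap.congr_fun hs v)⟩

/-- there is a well-defined alternating bilinear form `σ` on
`V = range(M − Id)` with `σ((M−Id)ξ, (M−Id)η) = (1/2)(B(ξ, Mη) − B(η, Mξ))`, and it
satisfies the fiberwise momentum condition
`σ((M−Id)ξ, v) = (1/2) B(ξ, v + M⁻¹ v)` for the inclusion of a conjugacy class. -/
theorem statement17 (K g : Type*) [Field K] [CharZero K]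
    [AddCommGroup g] [Module K g] [FiniteDimensional K g]
    (ψ : g ≃ₗ[K] Module.Dual K g) (hψsym : ∀ x y : g, ψ x y = ψ y x)
    (M : g ≃ₗ[K] g) (horth : ∀ x y : g, ψ (M x) (M y) = ψ x y) :
    ∃ σ : ↥(conjTangent K M) →ₗ[K] ↥(conjTangent K M) →ₗ[K] K,
      (∀ ξ η : g,
        σ ⟨M ξ - ξ, mem_conjTangent K M ξ⟩ ⟨M η - η, mem_conjTangent K M η⟩ =
          (2 : K)⁻¹ * (ψ ξ (M η) - ψ η (M ξ))) ∧
      (∀ v : ↥(conjTangent K M), σ v v = 0) ∧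
      (∀ (ξ : g) (v : ↥(conjTangent K M)),
        σ ⟨M ξ - ξ, mem_conjTangent K M ξ⟩ v =
          (2 : K)⁻¹ * ψ ξ ((v : g) + M.symm (v : g))) := by
  obtain ⟨s, hs⟩ := exists_section_conjTangent M
  have key := apply_add_symm_of_orthogonal (ψ : g →ₗ[K] Module.Dual K g) M horth
  simp only [LinearEquiv.coe_coe] at key
  let T : ↥(conjTangent K M) →ₗ[K] g :=
    (LinearMap.id + (M.symm : g →ₗ[K] g)) ∘ₗ (conjTangent K M).subtype
  let σ : ↥(conjTangent K M) →ₗ[K] ↥(conjTangent K M) →ₗ[K] K :=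
    (2 : K)⁻¹ • (ψ : g →ₗ[K] Module.Dual K g).compl₁₂ s T
  have hσ (v w : ↥(conjTangent K M)) :
      σ v w = (2 : K)⁻¹ * ψ (s v) ((w : g) + M.symm (w : g)) := rfl
  have momentum (ξ : g) (v : ↥(conjTangent K M)) :
      σ ⟨M ξ - ξ, mem_conjTangent K M ξ⟩ v =
        (2 : K)⁻¹ * ψ ξ ((v : g) + M.symm (v : g)) := by
    rw [hσ]
    congr 1
    set ξ' := s ⟨M ξ - ξ, mem_conjTangent K M ξ⟩
    have hfix : M (ξ' - ξ) = ξ' - ξ := by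
      have h : M ξ' - ξ' = M ξ - ξ := hs ⟨M ξ - ξ, mem_conjTangent K M ξ⟩
      rwa [map_sub, sub_eq_sub_iff_sub_eq_sub]
    have hv := key (ξ' - ξ) (s v)
    have hinv := horth (ξ' - ξ) (s v)
    rw [hfix] at hv hinv
    rwa [hinv, sub_self, hs, map_sub, LinearMap.sub_apply, sub_eq_zero] at hv
  have formula (ξ η : g) :
      σ ⟨M ξ - ξ, mem_conjTangent K M ξ⟩ ⟨M η - η, mem_conjTangent K M η⟩ =
        (2 : K)⁻¹ * (ψ ξ (M η) - ψ η (M ξ)) := by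
    rw [momentum, key, hψsym (M ξ) η]
  refine ⟨σ, formula, fun v => ?_, momentum⟩
  obtain ⟨_, ξ, rfl⟩ := v
  exact (formula ξ ξ).trans (by rw [sub_self, mul_zero])
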